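/- The trace space of the path algebra of the cyclic quiver with n vertices is isomorphic as a k-vector space to k[ρ] ⊕ k^n, where ρ is the class of the full cycle a_1 a_2 ⋯ a_n and the summand k^n is spanned by the classes of the vertex idempotents e_1,...,e_n; that is, HH_0(k⟨Q_n⟩) ≅ k[ρ] ⊕ k^n. -/

import Mathlib

/-- The k-submodule of an algebra spanned by all commutators `r*s - s*r`. -/
def commutatorSubmodule (k A : Type*) [CommRing k] [Ring A] [Algebra k A] :
    Submodule k A :=
  Submodule.span k {x : A | ∃ r s : A, x = r * s - s * r}

/-- Relations presenting the path algebra of the cyclic quiver with `n` vertices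
`v_1, …, v_n` and arrows `a_i : v_i → v_{i+1}` (indices mod `n`), as a quotient of the
free algebra on generators `Sum.inl i` (the trivial path `e_i` at `v_i`) and
`Sum.inr i` (the arrow `a_i`).  Multiplication is concatenation of paths, written
left-to-right, and is zero on non-composable paths; the sum of the vertex idempotents
is the unit. -/
inductive CyclicQuiverRel (k : Type*) [CommSemiring k] (n : ℕ) [NeZero n] :
    FreeAlgebra k (Fin n ⊕ Fin n) → FreeAlgebra k (Fin n ⊕ Fin n) → Prop
  | idem (i : Fin n) :
      CyclicQuiverRel k n
        (FreeAlgebra.ι k (Sum.inl i) * FreeAlgebra.ι k (Sum.inl i))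
        (FreeAlgebra.ι k (Sum.inl i))
  | orth (i j : Fin n) (h : i ≠ j) :
      CyclicQuiverRel k n
        (FreeAlgebra.ι k (Sum.inl i) * FreeAlgebra.ι k (Sum.inl j)) 0
  | src (i : Fin n) :
      CyclicQuiverRel k n
        (FreeAlgebra.ι k (Sum.inl i) * FreeAlgebra.ι k (Sum.inr i))
        (FreeAlgebra.ι k (Sum.inr i))
  | tgt (i : Fin n) :
      CyclicQuiverRel k n
        (FreeAlgebra.ι k (Sum.inr i) * FreeAlgebra.ι k (Sum.inl (i + 1)))
        (FreeAlgebra.ι k (Sum.inr i))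
  | srcZero (i j : Fin n) (h : j ≠ i) :
      CyclicQuiverRel k n
        (FreeAlgebra.ι k (Sum.inl j) * FreeAlgebra.ι k (Sum.inr i)) 0
  | tgtZero (i j : Fin n) (h : j ≠ i + 1) :
      CyclicQuiverRel k n
        (FreeAlgebra.ι k (Sum.inr i) * FreeAlgebra.ι k (Sum.inl j)) 0
  | unit :
      CyclicQuiverRel k n (∑ i : Fin n, FreeAlgebra.ι k (Sum.inl i)) 1

/-- The path algebra `k⟨Q_n⟩` of the cyclic quiver with `n` vertices. -/
abbrev CyclicPathAlgebra (k : Type*) [CommSemiring k] (n : ℕ) [NeZero n] :=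
  RingQuot (CyclicQuiverRel k n)

/-- The vertex idempotent `e_i` in the cyclic path algebra. -/
noncomputable def cyclicIdem (k : Type*) [CommSemiring k] (n : ℕ) [NeZero n] (i : Fin n) :
    CyclicPathAlgebra k n :=
  RingQuot.mkAlgHom k (CyclicQuiverRel k n) (FreeAlgebra.ι k (Sum.inl i))

/-- The arrow `a_i : v_i → v_{i+1}` in the cyclic path algebra. -/
noncomputable def cyclicArrow (k : Type*) [CommSemiring k] (n : ℕ) [NeZero n] (i : Fin n) :
    CyclicPathAlgebra k n :=
  RingQuot.mkAlgHom k (CyclicQuiverRel k n) (FreeAlgebra.ι k (Sum.inr i))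

/-- The full cycle `a_1 a_2 ⋯ a_n` in the cyclic path algebra. -/
noncomputable def cyclicFullCycle (k : Type*) [CommSemiring k] (n : ℕ) [NeZero n] :
    CyclicPathAlgebra k n :=
  (List.ofFn fun i : Fin n => cyclicArrow k n i).prod

section CyclicHelpers

open Polynomial

/-- The successor map on vertices. -/
def cycNext (n : ℕ) [NeZero n] (i : Fin n) : Fin n := i + 1

theorem cycNext_val (n : ℕ) [NeZero n] (i : Fin n) : (cycNext n i).val = (i.val + 1) % n := by
  unfold cycNext
  rw [Fin.val_add, Fin.val_one', Nat.add_mod_mod]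

theorem cycNext_iter_val (n : ℕ) [NeZero n] (l : ℕ) (i : Fin n) :
    ((cycNext n)^[l] i).val = (i.val + l) % n := by
  induction l generalizing i with
  | zero => simp [Nat.mod_eq_of_lt i.2]
  | succ l ih =>
    rw [Function.iterate_succ_apply, ih, cycNext_val, Nat.mod_add_mod]
    congr 1
    omega

theorem cycNext_iter_eq_iff (n : ℕ) [NeZero n] (l : ℕ) (i : Fin n) :
    (cycNext n)^[l] i = i ↔ n ∣ l := by
  rw [Fin.ext_iff, cycNext_iter_val]
  constructor
  · intro h
    have h2 : (i.val + l) ≡ i.val + 0 [MOD n] := by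
      unfold Nat.ModEq
      rw [h, add_zero, Nat.mod_eq_of_lt i.2]
    exact (Nat.modEq_zero_iff_dvd).1 (Nat.ModEq.add_left_cancel' _ h2)
  · rintro ⟨m, rfl⟩
    rw [Nat.add_mul_mod_self_left, Nat.mod_eq_of_lt i.2]

variable (k : Type*) [Field k] (n : ℕ) [NeZero n]

theorem cyc_idem_mul_idem (i j : Fin n) :
    cyclicIdem k n i * cyclicIdem k n j = if i = j then cyclicIdem k n i else 0 := by
  unfold cyclicIdem
  rw [← map_mul]
  split_ifs with h
  · subst h
    exact RingQuot.mkAlgHom_rel k (CyclicQuiverRel.idem i)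
  · rw [RingQuot.mkAlgHom_rel k (CyclicQuiverRel.orth i j h), map_zero]

theorem cyc_idem_mul_arrow (j i : Fin n) :
    cyclicIdem k n j * cyclicArrow k n i = if j = i then cyclicArrow k n i else 0 := by
  unfold cyclicIdem cyclicArrow
  rw [← map_mul]
  split_ifs with h
  · subst h
    exact RingQuot.mkAlgHom_rel k (CyclicQuiverRel.src j)
  · rw [RingQuot.mkAlgHom_rel k (CyclicQuiverRel.srcZero i j h), map_zero]

theorem cyc_arrow_mul_idem (i j : Fin n) :
    cyclicArrow k n i * cyclicIdem k n j = if j = cycNext n i then cyclicArrow k n i else 0 := by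
  unfold cyclicIdem cyclicArrow
  rw [← map_mul]
  split_ifs with h
  · subst h
    exact RingQuot.mkAlgHom_rel k (CyclicQuiverRel.tgt i)
  · rw [RingQuot.mkAlgHom_rel k (CyclicQuiverRel.tgtZero i j h), map_zero]

theorem cyc_sum_idem : ∑ i : Fin n, cyclicIdem k n i = 1 := by
  unfold cyclicIdem
  rw [← map_sum, RingQuot.mkAlgHom_rel k (CyclicQuiverRel.unit), map_one]

/-- The path of length `l` starting at vertex `i`. -/
noncomputable def cycPath : ℕ → Fin n → CyclicPathAlgebra k n
  | 0, i => cyclicIdem k n i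
  | l + 1, i => cyclicArrow k n i * cycPath l (cycNext n i)

theorem cyc_idem_mul_path (l : ℕ) (i j : Fin n) :
    cyclicIdem k n j * cycPath k n l i = if j = i then cycPath k n l i else 0 := by
  cases l with
  | zero =>
    simp only [cycPath]
    rw [cyc_idem_mul_idem]
    split_ifs with h
    · rw [h]
    · rfl
  | succ l =>
    simp only [cycPath]
    rw [← mul_assoc, cyc_idem_mul_arrow]
    split_ifs <;> simp

theorem cyc_path_mul_idem (l : ℕ) (i j : Fin n) :
    cycPath k n l i * cyclicIdem k n j =
      if j = (cycNext n)^[l] i then cycPath k n l i else 0 := by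
  induction l generalizing i with
  | zero =>
    change cyclicIdem k n i * cyclicIdem k n j = if j = i then cyclicIdem k n i else 0
    rw [cyc_idem_mul_idem]
    by_cases h : j = i
    · rw [if_pos h, if_pos h.symm]
    · rw [if_neg h, if_neg (Ne.symm h)]
  | succ l ih =>
    simp only [cycPath]
    rw [mul_assoc, ih, Function.iterate_succ_apply]
    split_ifs <;> simp

theorem cyc_arrow_mul_path (l : ℕ) (i j : Fin n) :
    cyclicArrow k n j * cycPath k n l i =
      if cycNext n j = i then cycPath k n (l + 1) j else 0 := by
  split_ifs with h
  · subst h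
    rfl
  · have h1 : cycPath k n l i = cyclicIdem k n i * cycPath k n l i := by
      rw [cyc_idem_mul_path, if_pos rfl]
    rw [h1, ← mul_assoc, cyc_arrow_mul_idem, if_neg (fun h' => h h'.symm), zero_mul]

theorem cyc_path_mul_arrow (l : ℕ) (i : Fin n) :
    cycPath k n l i * cyclicArrow k n ((cycNext n)^[l] i) = cycPath k n (l + 1) i := by
  induction l generalizing i with
  | zero =>
    simp only [cycPath, Function.iterate_zero, id]
    rw [cyc_idem_mul_arrow, if_pos rfl, cyc_arrow_mul_idem, if_pos rfl]
  | succ l ih =>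
    rw [Function.iterate_succ_apply, cycPath, mul_assoc, ih, ← cycPath]

theorem cyc_path_eq_prod (l : ℕ) (hl : 0 < l) (i : Fin n) :
    cycPath k n l i = (List.ofFn fun j : Fin l => cyclicArrow k n ((cycNext n)^[j.val] i)).prod := by
  induction l generalizing i with
  | zero => omega
  | succ l ih =>
    rw [List.ofFn_succ, List.prod_cons]
    rcases Nat.eq_zero_or_pos l with rfl | h
    · simp [cycPath, cyc_arrow_mul_idem]
    · rw [cycPath, ih h]
      simp [Function.iterate_succ_apply]

theorem cyc_fullCycle_eq : cyclicFullCycle k n = cycPath k n n 0 := by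
  rw [cyc_path_eq_prod k n n (Nat.pos_of_neZero n), cyclicFullCycle]
  congr 2
  funext j
  congr 1
  ext
  rw [cycNext_iter_val]
  simp [Nat.mod_eq_of_lt j.2]

theorem cyc_span_top :
    Submodule.span k (Set.range fun p : ℕ × Fin n => cycPath k n p.1 p.2) = ⊤ := by
  set S := Submodule.span k (Set.range fun p : ℕ × Fin n => cycPath k n p.1 p.2) with hS
  have hmem : ∀ l i, cycPath k n l i ∈ S := fun l i => Submodule.subset_span ⟨(l, i), rfl⟩
  have key : ∀ x : FreeAlgebra k (Fin n ⊕ Fin n), ∀ y ∈ S,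
      RingQuot.mkAlgHom k (CyclicQuiverRel k n) x * y ∈ S := by
    intro x
    induction x using FreeAlgebra.induction with
    | grade0 r =>
      intro y hy
      rw [AlgHom.commutes, ← Algebra.smul_def]
      exact S.smul_mem _ hy
    | grade1 g =>
      intro y hy
      induction hy using Submodule.span_induction with
      | mem y hy =>
        obtain ⟨⟨l, i⟩, rfl⟩ := hy
        rcases g with j | j
        · change cyclicIdem k n j * cycPath k n l i ∈ S
          rw [cyc_idem_mul_path]
          split_ifs
          · exact hmem _ _
          · exact S.zero_mem
        · change cyclicArrow k n j * cycPath k n l i ∈ S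
          rw [cyc_arrow_mul_path]
          split_ifs
          · exact hmem _ _
          · exact S.zero_mem
      | zero => rw [mul_zero]; exact S.zero_mem
      | add a b _ _ ha hb => rw [mul_add]; exact S.add_mem ha hb
      | smul c a _ ha => rw [mul_smul_comm]; exact S.smul_mem _ ha
    | mul a b ha hb =>
      intro y hy
      rw [map_mul, mul_assoc]
      exact ha _ (hb _ hy)
    | add a b ha hb =>
      intro y hy
      rw [map_add, add_mul]
      exact S.add_mem (ha _ hy) (hb _ hy)
  rw [eq_top_iff]
  intro x _
  obtain ⟨x, rfl⟩ := RingQuot.mkAlgHom_surjective k (CyclicQuiverRel k n) x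
  have h1 : (1 : CyclicPathAlgebra k n) ∈ S := by
    rw [← cyc_sum_idem]
    exact S.sum_mem fun i _ => hmem 0 i
  simpa using key x 1 h1

/-- Graded matrix representation of the path algebra. -/
noncomputable def cycMat : CyclicPathAlgebra k n →ₐ[k] Matrix (Fin n) (Fin n) k[X] :=
  RingQuot.liftAlgHom k ⟨FreeAlgebra.lift k (Sum.elim (fun i => Matrix.single i i (1 : k[X]))
    (fun i => Matrix.single i (cycNext n i) (X : k[X]))), by
    intro x y h
    induction h with
    | idem i => simp
    | orth i j h => simp [h]
    | src i => simp
    | tgt i => simp [cycNext]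
    | srcZero i j h => simp [h]
    | tgtZero i j h => simp [cycNext, Ne.symm h]
    | unit =>
      simp only [map_sum, FreeAlgebra.lift_ι_apply, Sum.elim_inl, map_one]
      ext i j
      simp [Matrix.sum_apply, Matrix.single_apply, Matrix.one_apply, ite_and]⟩

theorem cycMat_idem (i : Fin n) : cycMat k n (cyclicIdem k n i) = Matrix.single i i 1 := by
  simp [cycMat, cyclicIdem]

theorem cycMat_arrow (i : Fin n) :
    cycMat k n (cyclicArrow k n i) = Matrix.single i (cycNext n i) X := by
  simp [cycMat, cyclicArrow]

theorem cycMat_path (l : ℕ) (i : Fin n) :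
    cycMat k n (cycPath k n l i) = Matrix.single i ((cycNext n)^[l] i) (X ^ l) := by
  induction l generalizing i with
  | zero => simp [cycPath, cycMat_idem]
  | succ l ih =>
    rw [cycPath, map_mul, ih, cycMat_arrow, Matrix.single_mul_single_same,
      Function.iterate_succ_apply, pow_succ']

/-- The quotient of the path algebra by its arrows. -/
noncomputable def cycDiag : CyclicPathAlgebra k n →ₐ[k] (Fin n → k) :=
  RingQuot.liftAlgHom k ⟨FreeAlgebra.lift k (Sum.elim (fun i => Pi.single i (1 : k))
    (fun _ => 0)), by
    intro x y h
    induction h with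
    | idem i => simp [← Pi.single_mul]
    | orth i j h =>
      simp only [map_mul, FreeAlgebra.lift_ι_apply, Sum.elim_inl, map_zero]
      ext t
      simp only [Pi.mul_apply, Pi.single_apply, Pi.zero_apply]
      grind
    | src i => simp
    | tgt i => simp
    | srcZero i j h => simp
    | tgtZero i j h => simp
    | unit =>
      simp only [map_sum, FreeAlgebra.lift_ι_apply, Sum.elim_inl, map_one]
      ext t
      simp [Pi.single_apply]⟩

theorem cycDiag_path_zero (i : Fin n) : cycDiag k n (cycPath k n 0 i) = Pi.single i 1 := by
  simp [cycDiag, cyclicIdem, cycPath]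

theorem cycDiag_path_succ (l : ℕ) (i : Fin n) : cycDiag k n (cycPath k n (l + 1) i) = 0 := by
  rw [cycPath, map_mul]
  simp [cycDiag, cyclicArrow]

/-- Reindexing of the powers: `X^(n*(m+1))` goes to `X^(σ m)` with `σ` the swap of `0, 1`. -/
noncomputable def cycReindex : k[X] →ₗ[k] k[X] :=
  (Polynomial.basisMonomials k).constr k
    fun l => if n ∣ l ∧ l ≠ 0 then X ^ (Equiv.swap 0 1 (l / n - 1)) else 0

theorem cycReindex_pow (l : ℕ) : cycReindex k n (X ^ l) =
    if n ∣ l ∧ l ≠ 0 then X ^ (Equiv.swap 0 1 (l / n - 1)) else 0 := by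
  have := (Polynomial.basisMonomials k).constr_basis k
    (fun l => if n ∣ l ∧ l ≠ 0 then (X : k[X]) ^ (Equiv.swap 0 1 (l / n - 1)) else 0) l
  simp only [Polynomial.coe_basisMonomials, Polynomial.monomial_one_right_eq_X_pow] at this
  exact this

/-- The forward map before passing to the quotient. -/
noncomputable def cycFwd : CyclicPathAlgebra k n →ₗ[k] k[X] × (Fin n → k) :=
  ((cycReindex k n).comp ((Matrix.traceLinearMap (Fin n) k k[X]).comp
    (cycMat k n).toLinearMap)).prod (cycDiag k n).toLinearMap

theorem cycFwd_apply (x : CyclicPathAlgebra k n) :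
    cycFwd k n x = (cycReindex k n (Matrix.trace (cycMat k n x)), cycDiag k n x) := rfl

theorem cycFwd_comm : commutatorSubmodule k (CyclicPathAlgebra k n) ≤
    LinearMap.ker (cycFwd k n) := by
  unfold commutatorSubmodule
  rw [Submodule.span_le]
  rintro _ ⟨r, s, rfl⟩
  rw [SetLike.mem_coe, LinearMap.mem_ker, cycFwd_apply, map_sub, map_sub, map_mul, map_mul,
    Matrix.trace_sub, Matrix.trace_mul_comm, sub_self, map_mul, map_mul, mul_comm, sub_self,
    map_zero]
  rfl

theorem cycFwd_path_zero (i : Fin n) : cycFwd k n (cycPath k n 0 i) = (0, Pi.single i 1) := by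
  rw [cycFwd_apply, cycDiag_path_zero, cycMat_path, Function.iterate_zero, id,
    Matrix.trace_single_eq_same, cycReindex_pow, if_neg (by simp)]

theorem cycFwd_path_of_dvd (m : ℕ) (i : Fin n) :
    cycFwd k n (cycPath k n (n * (m + 1)) i) = (X ^ (Equiv.swap 0 1 m), 0) := by
  have hn := Nat.pos_of_neZero n
  have hpos : 0 < n * (m + 1) := Nat.mul_pos hn (Nat.succ_pos m)
  have hd : cycDiag k n (cycPath k n (n * (m + 1)) i) = 0 := by
    obtain ⟨l, hl⟩ := Nat.exists_eq_succ_of_ne_zero hpos.ne'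
    rw [hl]
    exact cycDiag_path_succ k n l i
  rw [cycFwd_apply, hd, cycMat_path, (cycNext_iter_eq_iff n _ i).2 (Dvd.intro _ rfl),
    Matrix.trace_single_eq_same, cycReindex_pow, if_pos ⟨Dvd.intro _ rfl, hpos.ne'⟩,
    Nat.mul_div_cancel_left _ hn, Nat.add_sub_cancel]

/-- The class of an element in the trace space. -/
noncomputable def cycCls : CyclicPathAlgebra k n →ₗ[k]
    (CyclicPathAlgebra k n ⧸ commutatorSubmodule k (CyclicPathAlgebra k n)) :=
  Submodule.mkQ _

theorem cycCls_comm (x y : CyclicPathAlgebra k n) : cycCls k n (x * y) = cycCls k n (y * x) := by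
  unfold cycCls
  rw [Submodule.mkQ_apply, Submodule.mkQ_apply, Submodule.Quotient.eq]
  exact Submodule.subset_span ⟨x, y, rfl⟩

theorem cycCls_path_zero (l : ℕ) (i : Fin n) (h : ¬ n ∣ l) : cycCls k n (cycPath k n l i) = 0 := by
  have h1 := cycCls_comm k n (cyclicIdem k n i) (cycPath k n l i)
  rw [cyc_idem_mul_path, if_pos rfl, cyc_path_mul_idem, if_neg, map_zero] at h1
  · exact h1
  · intro h2
    exact h ((cycNext_iter_eq_iff n l i).1 h2.symm)

theorem cycCls_path_next (l : ℕ) (hl : l ≠ 0) (i : Fin n) (h : n ∣ l) :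
    cycCls k n (cycPath k n l i) = cycCls k n (cycPath k n l (cycNext n i)) := by
  obtain ⟨l, rfl⟩ := Nat.exists_eq_succ_of_ne_zero hl
  have h2 := (cycNext_iter_eq_iff n _ i).2 h
  rw [Function.iterate_succ_apply] at h2
  conv_lhs => rw [Nat.succ_eq_add_one, cycPath]
  rw [cycCls_comm]
  conv_lhs => rw [← h2, h2]
  have h3 := cyc_path_mul_arrow k n l (cycNext n i)
  rw [h2] at h3
  rw [h3]

theorem cycCls_path_eq (l : ℕ) (hl : l ≠ 0) (i : Fin n) (h : n ∣ l) :
    cycCls k n (cycPath k n l i) = cycCls k n (cycPath k n l 0) := by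
  have h1 : ∀ t : ℕ, cycCls k n (cycPath k n l ((cycNext n)^[t] 0)) =
      cycCls k n (cycPath k n l 0) := by
    intro t
    induction t with
    | zero => rfl
    | succ t ih => rw [Function.iterate_succ_apply', ← cycCls_path_next k n l hl _ h, ih]
  have h2 : (cycNext n)^[i.val] 0 = i := by
    ext
    rw [cycNext_iter_val]
    simp [Nat.mod_eq_of_lt i.2]
  rw [← h1 i.val, h2]

/-- The forward map on the trace space. -/
noncomputable def cycE : (CyclicPathAlgebra k n ⧸ commutatorSubmodule k (CyclicPathAlgebra k n))
    →ₗ[k] k[X] × (Fin n → k) :=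
  Submodule.liftQ _ (cycFwd k n) (cycFwd_comm k n)

theorem cycE_cls (x : CyclicPathAlgebra k n) : cycE k n (cycCls k n x) = cycFwd k n x :=
  Submodule.liftQ_apply _ _ _

/-- The inverse map. -/
noncomputable def cycG : k[X] × (Fin n → k) →ₗ[k]
    (CyclicPathAlgebra k n ⧸ commutatorSubmodule k (CyclicPathAlgebra k n)) :=
  LinearMap.coprod
    ((Polynomial.basisMonomials k).constr k
      fun m => cycCls k n (cycPath k n (n * (Equiv.swap 0 1 m + 1)) 0))
    ((Pi.basisFun k (Fin n)).constr k fun i => cycCls k n (cycPath k n 0 i))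

theorem cycG_pow (m : ℕ) :
    cycG k n (X ^ m, 0) = cycCls k n (cycPath k n (n * (Equiv.swap 0 1 m + 1)) 0) := by
  have := (Polynomial.basisMonomials k).constr_basis k
    (fun m => cycCls k n (cycPath k n (n * (Equiv.swap 0 1 m + 1)) 0)) m
  simp only [Polynomial.coe_basisMonomials, Polynomial.monomial_one_right_eq_X_pow] at this
  rw [cycG, LinearMap.coprod_apply, map_zero, add_zero]
  exact this

theorem cycG_single (i : Fin n) :
    cycG k n (0, Pi.single i 1) = cycCls k n (cycPath k n 0 i) := by
  have := (Pi.basisFun k (Fin n)).constr_basis k (fun i => cycCls k n (cycPath k n 0 i)) i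
  rw [Pi.basisFun_apply] at this
  rw [cycG, LinearMap.coprod_apply, map_zero, zero_add]
  exact this

theorem cycE_comp_cycG : (cycE k n).comp (cycG k n) = LinearMap.id := by
  apply LinearMap.prod_ext
  · apply (Polynomial.basisMonomials k).ext
    intro m
    simp only [Polynomial.coe_basisMonomials, Polynomial.monomial_one_right_eq_X_pow]
    simp only [LinearMap.comp_apply, LinearMap.inl_apply, LinearMap.id_apply]
    rw [cycG_pow, cycE_cls, cycFwd_path_of_dvd, Equiv.swap_apply_self]
  · apply (Pi.basisFun k (Fin n)).ext
    intro i
    rw [Pi.basisFun_apply]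
    simp only [LinearMap.comp_apply, LinearMap.inr_apply, LinearMap.id_apply]
    rw [cycG_single, cycE_cls, cycFwd_path_zero]

theorem cycG_comp_cycE : (cycG k n).comp (cycE k n) = LinearMap.id := by
  apply Submodule.linearMap_qext
  apply LinearMap.ext_on_range (cyc_span_top k n)
  rintro ⟨l, i⟩
  change cycG k n (cycE k n (cycCls k n (cycPath k n l i))) = cycCls k n (cycPath k n l i)
  by_cases h : n ∣ l
  · rcases Nat.eq_zero_or_pos l with rfl | hl
    · rw [cycE_cls, cycFwd_path_zero, cycG_single]
    · rw [cycCls_path_eq k n l hl.ne' i h]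
      obtain ⟨m, rfl⟩ := h
      obtain ⟨m, rfl⟩ : ∃ m', m = m' + 1 :=
        Nat.exists_eq_succ_of_ne_zero (by rintro rfl; simp at hl)
      rw [cycE_cls, cycFwd_path_of_dvd, cycG_pow, Equiv.swap_apply_self]
  · rw [cycCls_path_zero k n l i h, map_zero, map_zero]

end CyclicHelpers

/-- The trace space `HH_0(k⟨Q_n⟩) = k⟨Q_n⟩ / [k⟨Q_n⟩, k⟨Q_n⟩]` of the
path algebra of the cyclic quiver with `n` vertices is isomorphic as a `k`-vector space
to `k[ρ] ⊕ k^n`, where `ρ` is the class of the full cycle `a_1 a_2 ⋯ a_n` and the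
summand `k^n` is spanned by the classes of the vertex idempotents `e_1, …, e_n`. -/
theorem traceSpace_cyclicPathAlgebra (k : Type*) [Field k] (n : ℕ) [NeZero n] :
    ∃ E : (CyclicPathAlgebra k n ⧸ commutatorSubmodule k (CyclicPathAlgebra k n)) ≃ₗ[k]
        (Polynomial k × (Fin n → k)),
      E (Submodule.Quotient.mk (cyclicFullCycle k n)) = (Polynomial.X, 0) ∧
      ∀ i : Fin n,
        E (Submodule.Quotient.mk (cyclicIdem k n i)) = (0, Pi.single i 1) := by
  refine ⟨LinearEquiv.ofLinear (cycE k n) (cycG k n) (cycE_comp_cycG k n) (cycG_comp_cycE k n),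
    ?_, ?_⟩
  · change cycE k n (cycCls k n (cyclicFullCycle k n)) = _
    have h := cycFwd_path_of_dvd k n 0 0
    rw [zero_add, mul_one, Equiv.swap_apply_left, pow_one] at h
    rw [cycE_cls, cyc_fullCycle_eq, h]
  · intro i
    change cycE k n (cycCls k n (cycPath k n 0 i)) = _
    rw [cycE_cls, cycFwd_path_zero]
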